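/- arXiv:1212.5099 — 2 statements merged into one kernel-verified Lean document; each statement's English description precedes it below -/
import Mathlib

section
/- For every integer n ≥ 1, the biharmonic heat kernel profile f_n satisfies the third order ODE f_n'''(η) + ((n−1)/η) f_n''(η) − ((n−1)/η²) f_n'(η) − (η/4) f_n(η) = 0 for all η > 0. -/
open MeasureTheory Real Filter Topology

noncomputable def besselJ (ν y : ℝ) : ℝ :=
  ∑' k : ℕ, (-1 : ℝ) ^ k * (y / 2) ^ ((2 * k : ℝ) + ν) /
    (Nat.factorial k * Real.Gamma ((k : ℝ) + ν + 1))

noncomputable def fmn (m n : ℕ) (η : ℝ) : ℝ :=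
  η ^ ((1 : ℝ) - n) *
    ∫ s in Set.Ioi (0 : ℝ),
      Real.exp (-(s ^ (2 * m))) * (η * s) ^ ((n : ℝ) / 2) *
        besselJ (((n : ℝ) - 2) / 2) (η * s)

/-- Entire power series: termwise differentiation. -/
lemma ps_deriv_summable (c : ℕ → ℝ) (hc : ∀ r : ℝ, 0 ≤ r → Summable (fun k => |c k| * r ^ k)) :
    ∀ r : ℝ, 0 ≤ r → Summable (fun k : ℕ => |((k : ℝ) + 1) * c (k + 1)| * r ^ k) := by
  intro r hr
  have h1 := (summable_nat_add_iff 1).2 (hc (2 * (r + 1)) (by positivity))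
  refine Summable.of_nonneg_of_le (fun k => by positivity) (fun k => ?_) h1
  rw [abs_mul, abs_of_nonneg (by positivity : (0 : ℝ) ≤ (k : ℝ) + 1), mul_comm ((k : ℝ) + 1),
    mul_assoc]
  refine mul_le_mul_of_nonneg_left ?_ (abs_nonneg _)
  rw [mul_pow]
  have h2 : (k : ℝ) + 1 ≤ 2 ^ (k + 1) := by
    have := (Nat.lt_two_pow_self (n := k + 1)).le
    exact_mod_cast this
  have h3 : r ^ k ≤ (r + 1) ^ (k + 1) :=
    calc r ^ k ≤ (r + 1) ^ k := by gcongr; linarith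
      _ ≤ (r + 1) ^ (k + 1) := pow_le_pow_right₀ (by linarith) (by omega)
  exact mul_le_mul h2 h3 (by positivity) (by positivity)

lemma ps_summable (c : ℕ → ℝ) (hc : ∀ r : ℝ, 0 ≤ r → Summable (fun k => |c k| * r ^ k)) (x : ℝ) :
    Summable (fun k => c k * x ^ k) := by
  refine Summable.of_norm ?_
  simpa [abs_mul] using hc |x| (abs_nonneg x)

lemma ps_hasDerivAt (c : ℕ → ℝ) (hc : ∀ r : ℝ, 0 ≤ r → Summable (fun k => |c k| * r ^ k)) (x : ℝ) :
    HasDerivAt (fun y : ℝ => ∑' k, c k * y ^ k)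
      (∑' k : ℕ, (((k : ℝ) + 1) * c (k + 1)) * x ^ k) x := by
  have hs := ps_deriv_summable c hc (|x| + 1) (by positivity)
  have hu : Summable (fun k : ℕ => |c k * k| * (|x| + 1) ^ (k - 1)) := by
    rw [← summable_nat_add_iff 1]
    refine hs.congr (fun k => ?_)
    simp [mul_comm]
  have h := hasDerivAt_tsum_of_isPreconnected (g := fun k y => c k * y ^ k)
    (g' := fun k y => c k * (k * y ^ (k - 1))) (t := Metric.ball (0 : ℝ) (|x| + 1)) (y₀ := 0) (y := x)
    hu Metric.isOpen_ball (convex_ball _ _).isPreconnected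
    (fun k y _ => (hasDerivAt_pow k y).const_mul (c k))
    (fun k y hy => by
      have hy' : |y| ≤ |x| + 1 := by simpa using (mem_ball_zero_iff.1 hy).le
      rw [Real.norm_eq_abs, ← mul_assoc, abs_mul, abs_pow]
      gcongr)
    (Metric.mem_ball_self (by positivity)) (ps_summable c hc 0)
    (by rw [mem_ball_zero_iff, Real.norm_eq_abs]; linarith)
  refine h.congr_deriv ?_
  have hsum : Summable (fun k : ℕ => c k * (k * x ^ (k - 1))) := by
    rw [← summable_nat_add_iff 1]
    refine (ps_summable _ (ps_deriv_summable c hc) x).congr (fun k => ?_)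
    push_cast; ring
  rw [hsum.tsum_eq_zero_add]
  simp only [Nat.cast_zero, zero_mul, mul_zero, zero_add]
  refine tsum_congr (fun k => ?_)
  push_cast; ring

/-- Taylor coefficients of the profile in powers of `η ^ 2`. -/
noncomputable def profCoef (n k : ℕ) : ℝ :=
  (-1 : ℝ) ^ k / (Nat.factorial k * Real.Gamma ((k : ℝ) + ((n : ℝ) - 2) / 2 + 1))
    * (1 / 2 : ℝ) ^ ((2 * k : ℝ) + ((n : ℝ) - 2) / 2) * (1 / 4 * Real.Gamma ((2 * k + n : ℝ) / 4))

lemma profCoef_rec (n : ℕ) (hn : 1 ≤ n) (k : ℕ) :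
    ((k : ℝ) + 2) * (k + 1) * (8 * k + 4 * n + 8) * profCoef n (k + 2) = profCoef n k / 4 := by
  have hn' : (1 : ℝ) ≤ n := by exact_mod_cast hn
  have hk : (0 : ℝ) ≤ k := Nat.cast_nonneg k
  unfold profCoef
  have e1 : Real.Gamma (((k + 2 : ℕ) : ℝ) + ((n : ℝ) - 2) / 2 + 1)
      = ((k : ℝ) + n / 2 + 1) * (((k : ℝ) + n / 2) * Real.Gamma ((k : ℝ) + ((n : ℝ) - 2) / 2 + 1)) := by
    rw [show ((k + 2 : ℕ) : ℝ) + ((n : ℝ) - 2) / 2 + 1 = ((k : ℝ) + n / 2 + 1) + 1 by push_cast; ring,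
      Real.Gamma_add_one (by positivity), Real.Gamma_add_one (by positivity)]
    rw [show (k : ℝ) + ((n : ℝ) - 2) / 2 + 1 = (k : ℝ) + n / 2 by ring]
  have e2 : Real.Gamma ((2 * ((k + 2 : ℕ) : ℝ) + n) / 4)
      = ((2 * k + n : ℝ) / 4) * Real.Gamma ((2 * k + n : ℝ) / 4) := by
    rw [← Real.Gamma_add_one (by positivity)]
    congr 1; push_cast; ring
  have e3 : (1 / 2 : ℝ) ^ ((2 * ((k + 2 : ℕ) : ℝ)) + ((n : ℝ) - 2) / 2)
      = (1 / 2 : ℝ) ^ ((2 * k : ℝ) + ((n : ℝ) - 2) / 2) * (1 / 16) := by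
    rw [show (2 * ((k + 2 : ℕ) : ℝ)) + ((n : ℝ) - 2) / 2
      = ((2 * k : ℝ) + ((n : ℝ) - 2) / 2) + (4 : ℕ) by push_cast; ring,
      Real.rpow_add_natCast (by norm_num)]
    norm_num
  have hG : Real.Gamma ((k : ℝ) + ((n : ℝ) - 2) / 2 + 1) ≠ 0 :=
    (Real.Gamma_pos_of_pos (by linarith)).ne'
  have hf : (Nat.factorial k : ℝ) ≠ 0 := by positivity
  have h1 : (k : ℝ) + n / 2 + 1 ≠ 0 := by positivity
  have h2 : (k : ℝ) + n / 2 ≠ 0 := by positivity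
  rw [e1, e2, e3, Nat.factorial_succ, Nat.factorial_succ]
  generalize Real.Gamma ((k : ℝ) + ((n : ℝ) - 2) / 2 + 1) = G at *
  generalize Real.Gamma ((2 * k + n : ℝ) / 4) = H at *
  generalize (1 / 2 : ℝ) ^ ((2 * k : ℝ) + ((n : ℝ) - 2) / 2) = P at *
  have h3 : (k : ℝ) + 1 ≠ 0 := by positivity
  have h4 : (k : ℝ) + 1 + 1 ≠ 0 := by positivity
  have h5 : (k : ℝ) * 2 + n ≠ 0 := by positivity
  have h6 : (k : ℝ) * 2 + n + 2 ≠ 0 := by positivity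
  push_cast
  rw [pow_add]
  have h7 : (k : ℝ) + n / 2 = (k * 2 + n) / 2 := by ring
  have h8 : (k : ℝ) + n / 2 + 1 = (k * 2 + n + 2) / 2 := by ring
  rw [h8, h7]
  field_simp
  ring

lemma profCoef_ne (n : ℕ) (hn : 1 ≤ n) (k : ℕ) : profCoef n k ≠ 0 := by
  have hn' : (1 : ℝ) ≤ n := by exact_mod_cast hn
  have hk : (0 : ℝ) ≤ k := Nat.cast_nonneg k
  unfold profCoef
  have hG : Real.Gamma ((k : ℝ) + ((n : ℝ) - 2) / 2 + 1) ≠ 0 :=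
    (Real.Gamma_pos_of_pos (by linarith)).ne'
  have hH : Real.Gamma ((2 * k + n : ℝ) / 4) ≠ 0 :=
    (Real.Gamma_pos_of_pos (by positivity)).ne'
  have hf : (Nat.factorial k : ℝ) ≠ 0 := by positivity
  have hP : (1 / 2 : ℝ) ^ ((2 * k : ℝ) + ((n : ℝ) - 2) / 2) ≠ 0 := by positivity
  have : (-1 : ℝ) ^ k ≠ 0 := by simp
  positivity

lemma profCoef_bound (n : ℕ) (hn : 1 ≤ n) (k : ℕ) :
    |profCoef n (k + 2)| ≤ |profCoef n k| / (k + 1) := by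
  have hk : (0 : ℝ) ≤ k := Nat.cast_nonneg k
  have hn' : (1 : ℝ) ≤ n := by exact_mod_cast hn
  have h := congrArg abs (profCoef_rec n hn k)
  rw [abs_mul, abs_div, abs_of_nonneg (by positivity), abs_of_nonneg (by norm_num : (0:ℝ) ≤ 4)] at h
  rw [le_div_iff₀ (by positivity)]
  have h2 : (1 : ℝ) ≤ (k + 2) * (8 * k + 4 * n + 8) := by nlinarith
  have := mul_le_mul_of_nonneg_left h2
    (by positivity : 0 ≤ |profCoef n (k + 2)| * ((k : ℝ) + 1))
  have := abs_nonneg (profCoef n k)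
  nlinarith

lemma step2_summable (b : ℕ → ℝ) (hb : ∀ k, 0 ≤ b k) (C : ℝ) (hC : 0 ≤ C)
    (h : ∀ k : ℕ, b (k + 2) ≤ C / (k + 1) * b k) : Summable b := by
  have key : ∀ i : ℕ, Summable (fun j => b (2 * j + i)) := by
    intro i
    obtain ⟨N, hN⟩ := exists_nat_ge (2 * C)
    refine summable_of_ratio_norm_eventually_le (r := 1 / 2) (by norm_num) ?_
    filter_upwards [Filter.eventually_ge_atTop N] with j hj
    rw [Real.norm_of_nonneg (hb _), Real.norm_of_nonneg (hb _)]
    have h1 := h (2 * j + i)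
    rw [show 2 * j + i + 2 = 2 * (j + 1) + i by ring] at h1
    refine h1.trans (mul_le_mul_of_nonneg_right ?_ (hb _))
    have hj' : (N : ℝ) ≤ j := by exact_mod_cast hj
    have : (0 : ℝ) ≤ i := Nat.cast_nonneg i
    have : (0 : ℝ) ≤ j := Nat.cast_nonneg j
    push_cast
    rw [div_le_iff₀ (by positivity)]
    linarith
  exact ((key 0).hasSum.even_add_odd (key 1).hasSum).summable

lemma profCoef_summable (n : ℕ) (hn : 1 ≤ n) (r : ℝ) (hr : 0 ≤ r) :
    Summable (fun k => |profCoef n k| * r ^ k) := by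
  refine step2_summable _ (fun k => by positivity) (r ^ 2) (by positivity) (fun k => ?_)
  have := mul_le_mul_of_nonneg_right (profCoef_bound n hn k) (by positivity : 0 ≤ r ^ (k + 2))
  refine this.trans (le_of_eq ?_)
  rw [pow_add]; ring

lemma fmn_eq (n : ℕ) (hn : 1 ≤ n) (η : ℝ) (hη : 0 < η) :
    fmn 2 n η = ∑' k, profCoef n k * (η ^ 2) ^ k := by
  have hn' : (1 : ℝ) ≤ n := by exact_mod_cast hn
  set d : ℕ → ℝ := fun k => (-1 : ℝ) ^ k /
    (Nat.factorial k * Real.Gamma ((k : ℝ) + ((n : ℝ) - 2) / 2 + 1))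
    * (1 / 2 : ℝ) ^ ((2 * k : ℝ) + ((n : ℝ) - 2) / 2) * η ^ ((2 * k : ℝ) + n - 1) with hd
  set F : ℕ → ℝ → ℝ := fun k s => d k * (s ^ ((2 * k : ℝ) + n - 1) * Real.exp (-s ^ (4 : ℝ))) with hF
  have hq : ∀ k : ℕ, (-1 : ℝ) < (2 * k : ℝ) + n - 1 := fun k => by
    have : (0 : ℝ) ≤ k := Nat.cast_nonneg k
    linarith
  have hIntg : ∀ k, Integrable (F k) (volume.restrict (Set.Ioi 0)) := fun k =>
    (integrableOn_rpow_mul_exp_neg_rpow (hq k) (by norm_num)).const_mul (d k)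
  have hI : ∀ k : ℕ, ∫ s in Set.Ioi (0 : ℝ), s ^ ((2 * k : ℝ) + n - 1) * Real.exp (-s ^ (4 : ℝ))
      = 1 / 4 * Real.Gamma ((2 * k + n : ℝ) / 4) := fun k => by
    rw [integral_rpow_mul_exp_neg_rpow (by norm_num) (hq k)]
    congr 3; ring
  have hη2 : ∀ k : ℕ, η ^ ((2 * k : ℝ) + n - 1) = η ^ ((n : ℝ) - 1) * (η ^ 2) ^ k := fun k => by
    rw [show (2 * k : ℝ) + n - 1 = ((n : ℝ) - 1) + ((2 * k : ℕ) : ℝ) by push_cast; ring,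
      Real.rpow_add_natCast hη.ne', pow_mul]
  have hval : ∀ k, d k * (1 / 4 * Real.Gamma ((2 * k + n : ℝ) / 4))
      = η ^ ((n : ℝ) - 1) * (profCoef n k * (η ^ 2) ^ k) := fun k => by
    simp only [hd, profCoef, hη2]; ring
  have hFint : ∀ k, ∫ s in Set.Ioi (0 : ℝ), F k s
      = η ^ ((n : ℝ) - 1) * (profCoef n k * (η ^ 2) ^ k) := fun k => by
    rw [← hval, ← hI k, hF, integral_const_mul]
  have hnorm : ∀ k, ∫ s in Set.Ioi (0 : ℝ), ‖F k s‖
      = η ^ ((n : ℝ) - 1) * (|profCoef n k| * (η ^ 2) ^ k) := fun k => by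
    have h1 : ∫ s in Set.Ioi (0 : ℝ), ‖F k s‖ = ∫ s in Set.Ioi (0 : ℝ),
        |d k| * (s ^ ((2 * k : ℝ) + n - 1) * Real.exp (-s ^ (4 : ℝ))) := by
      refine setIntegral_congr_fun measurableSet_Ioi (fun s hs => ?_)
      have hs' : (0 : ℝ) < s := hs
      simp only [hF, norm_mul, Real.norm_eq_abs]
      rw [abs_of_nonneg (by positivity : 0 ≤ s ^ ((2 * k : ℝ) + n - 1)), abs_of_pos (Real.exp_pos _)]
    have hG : 0 < Real.Gamma ((2 * k + n : ℝ) / 4) := Real.Gamma_pos_of_pos (by positivity)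
    have h2 := congrArg abs (hval k)
    rw [abs_mul (d k), abs_mul (η ^ ((n : ℝ) - 1)), abs_mul (profCoef n k), abs_of_pos (by positivity : 0 < 1 / 4 * Real.Gamma ((2 * k + n : ℝ) / 4)),
      abs_of_pos (by positivity : 0 < η ^ ((n : ℝ) - 1)),
      abs_of_pos (by positivity : 0 < (η ^ 2) ^ k)] at h2
    rw [h1, integral_const_mul, hI, h2]
  have hsum := hasSum_integral_of_summable_integral_norm hIntg (by
    simp only [hnorm]
    exact (profCoef_summable n hn (η ^ 2) (by positivity)).mul_left _)
  have hEq : ∫ s in Set.Ioi (0 : ℝ),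
      Real.exp (-(s ^ (2 * 2))) * (η * s) ^ ((n : ℝ) / 2) *
        besselJ (((n : ℝ) - 2) / 2) (η * s) = ∫ s in Set.Ioi (0 : ℝ), ∑' k, F k s := by
    refine setIntegral_congr_fun measurableSet_Ioi (fun s hs => ?_)
    have hs' : (0 : ℝ) < s := hs
    have hηs : 0 < η * s := mul_pos hη hs'
    simp only [besselJ, hF, hd]
    rw [← tsum_mul_left]
    refine tsum_congr (fun k => ?_)
    have e4 : s ^ (4 : ℝ) = s ^ (2 * 2) := by
      rw [show (4 : ℝ) = ((2 * 2 : ℕ) : ℝ) by norm_num, Real.rpow_natCast]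
    have e5 : (η * s) ^ ((2 * k : ℝ) + n - 1)
        = (η * s) ^ ((n : ℝ) / 2) * (η * s) ^ ((2 * k : ℝ) + ((n : ℝ) - 2) / 2) := by
      rw [← Real.rpow_add hηs]; congr 1; ring
    have e6 : (η * s / 2) ^ ((2 * k : ℝ) + ((n : ℝ) - 2) / 2)
        = (η * s) ^ ((2 * k : ℝ) + ((n : ℝ) - 2) / 2) * (1 / 2) ^ ((2 * k : ℝ) + ((n : ℝ) - 2) / 2) := by
      rw [← Real.mul_rpow hηs.le (by norm_num)]; congr 1; ring
    rw [e4, e6]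
    rw [Real.mul_rpow hη.le hs'.le (z := (2 * k : ℝ) + n - 1)] at e5
    linear_combination (-((-1 : ℝ) ^ k /
      (Nat.factorial k * Real.Gamma ((k : ℝ) + ((n : ℝ) - 2) / 2 + 1))
      * (1 / 2 : ℝ) ^ ((2 * k : ℝ) + ((n : ℝ) - 2) / 2) * Real.exp (-(s ^ (2 * 2))))) * e5
  unfold fmn
  rw [hEq, ← hsum.tsum_eq]
  simp only [hFint]
  rw [tsum_mul_left, ← mul_assoc, ← Real.rpow_add hη]
  simp

/-- the biharmonic heat kernel profile `f_n = f_{2,n}` satisfies the third order ODE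
`f_n''' + ((n-1)/η) f_n'' - ((n-1)/η²) f_n' - (η/4) f_n = 0` on `(0,∞)`. -/
theorem biharmonic_kernel_third_order_ODE (n : ℕ) (hn : 1 ≤ n) (η : ℝ) (hη : 0 < η) :
    deriv (deriv (deriv (fmn 2 n))) η
      + ((n : ℝ) - 1) / η * deriv (deriv (fmn 2 n)) η
      - ((n : ℝ) - 1) / η ^ 2 * deriv (fmn 2 n) η
      - η / 4 * fmn 2 n η = 0 := by
  set c0 : ℕ → ℝ := profCoef n with hc0
  set c1 : ℕ → ℝ := fun k => ((k : ℝ) + 1) * c0 (k + 1) with hc1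
  set c2 : ℕ → ℝ := fun k => ((k : ℝ) + 1) * c1 (k + 1) with hc2
  set c3 : ℕ → ℝ := fun k => ((k : ℝ) + 1) * c2 (k + 1) with hc3
  have s0 := profCoef_summable n hn
  have s1 := ps_deriv_summable c0 s0
  have s2 := ps_deriv_summable c1 s1
  have s3 := ps_deriv_summable c2 s2
  set g0 : ℝ → ℝ := fun y => ∑' k, c0 k * y ^ k with hg0
  set g1 : ℝ → ℝ := fun y => ∑' k, c1 k * y ^ k with hg1
  set g2 : ℝ → ℝ := fun y => ∑' k, c2 k * y ^ k with hg2
  set g3 : ℝ → ℝ := fun y => ∑' k, c3 k * y ^ k with hg3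
  have sq : ∀ x : ℝ, HasDerivAt (fun x : ℝ => x ^ 2) (2 * x) x := fun x => by
    simpa using hasDerivAt_pow 2 x
  have D0 : ∀ x : ℝ, HasDerivAt (fun x => g0 (x ^ 2)) (g1 (x ^ 2) * (2 * x)) x := fun x =>
    HasDerivAt.comp (h₂ := g0) x (ps_hasDerivAt c0 s0 (x ^ 2)) (sq x)
  have D1 : ∀ x : ℝ, HasDerivAt (fun x => g1 (x ^ 2)) (g2 (x ^ 2) * (2 * x)) x := fun x =>
    HasDerivAt.comp (h₂ := g1) x (ps_hasDerivAt c1 s1 (x ^ 2)) (sq x)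
  have D2 : ∀ x : ℝ, HasDerivAt (fun x => g2 (x ^ 2)) (g3 (x ^ 2) * (2 * x)) x := fun x =>
    HasDerivAt.comp (h₂ := g2) x (ps_hasDerivAt c2 s2 (x ^ 2)) (sq x)
  have lin : ∀ x : ℝ, HasDerivAt (fun x : ℝ => 2 * x) 2 x := fun x => by
    simpa using (hasDerivAt_id x).const_mul 2
  have ev : ∀ {u v : ℝ → ℝ}, (∀ x, 0 < x → u x = v x) → ∀ x, 0 < x → deriv u x = deriv v x := by
    intro u v h x hx
    apply Filter.EventuallyEq.deriv_eq
    filter_upwards [lt_mem_nhds hx] with y hy using h y hy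
  have f0 : ∀ x, 0 < x → fmn 2 n x = g0 (x ^ 2) := fun x hx => fmn_eq n hn x hx
  have f1 : ∀ x, 0 < x → deriv (fmn 2 n) x = g1 (x ^ 2) * (2 * x) := fun x hx => by
    rw [ev f0 x hx, (D0 x).deriv]
  have f2 : ∀ x, 0 < x → deriv (deriv (fmn 2 n)) x
      = g2 (x ^ 2) * (2 * x) * (2 * x) + g1 (x ^ 2) * 2 := fun x hx => by
    rw [ev f1 x hx]; exact ((D1 x).mul (lin x)).deriv
  have f3 : deriv (deriv (deriv (fmn 2 n))) η
      = (g3 (η ^ 2) * (2 * η) * (2 * η) + g2 (η ^ 2) * 2) * (2 * η) + g2 (η ^ 2) * (2 * η) * 2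
        + g2 (η ^ 2) * (2 * η) * 2 := by
    rw [ev f2 η hη]
    exact ((((D2 η).mul (lin η)).mul (lin η)).add ((D1 η).mul_const 2)).deriv
  have main : ∀ y : ℝ, 8 * (y * g3 y) + (4 * n + 8) * g2 y = g0 y / 4 := by
    intro y
    have t2 := ps_summable c2 s2 y
    have t3 := ps_summable c3 s3 y
    have hyg3 : y * g3 y = ∑' k : ℕ, (k : ℝ) * c2 k * y ^ k := by
      have ts : Summable (fun k : ℕ => (k : ℝ) * c2 k * y ^ k) := by
        rw [← summable_nat_add_iff 1]
        refine (t3.mul_left y).congr (fun k => ?_)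
        simp only [hc3]; push_cast; ring
      rw [ts.tsum_eq_zero_add, hg3, ← tsum_mul_left]
      simp only [Nat.cast_zero, zero_mul, zero_add]
      refine tsum_congr (fun k => ?_)
      simp only [hc3]; push_cast; ring
    have ts : Summable (fun k : ℕ => (k : ℝ) * c2 k * y ^ k) := by
      rw [← summable_nat_add_iff 1]
      refine (t3.mul_left y).congr (fun k => ?_)
      simp only [hc3]; push_cast; ring
    rw [hyg3, hg2, hg0]
    simp only
    rw [← tsum_mul_left, ← tsum_mul_left, ← tsum_div_const,
      ← (ts.mul_left 8).tsum_add (t2.mul_left _)]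
    refine tsum_congr (fun k => ?_)
    have := profCoef_rec n hn k
    simp only [hc2, hc1]
    rw [← hc0] at this
    push_cast
    linear_combination y ^ k * this
  rw [f3, f2 η hη, f1 η hη, f0 η hη]
  have := main (η ^ 2)
  field_simp
  linear_combination 4 * η ^ 2 * this
end

section
/- For all integers m ≥ 1 and n ≥ 1, the polyharmonic heat kernel profile f_{m,n} satisfies the (2m−1)-order ODE (Δ_r^{m−1} f_{m,n})'(η) = ((−1)^m/(2m)) · η · f_{m,n}(η) for all η > 0, where Δ_r is the n-dimensional radial Laplacian. -/
open MeasureTheory Real Filter Topology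

/-- The `n`-dimensional radial Laplacian `(Δ_r g)(η) = g''(η) + ((n-1)/η) g'(η)`. -/
noncomputable def radLap (n : ℕ) (g : ℝ → ℝ) : ℝ → ℝ :=
  fun η => deriv (deriv g) η + ((n : ℝ) - 1) / η * deriv g η

/-- coefficients of an everywhere convergent power series -/
def EntireSeq (a : ℕ → ℝ) : Prop := ∀ r : ℝ, 0 ≤ r → Summable (fun k => |a k| * r ^ k)

noncomputable def GG (a : ℕ → ℝ) (t : ℝ) : ℝ := ∑' k : ℕ, a k * t ^ k

lemma nat_le_two_pow (k : ℕ) : (k : ℝ) ≤ 2 ^ k := by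
  exact_mod_cast (Nat.lt_two_pow_self (n := k)).le

lemma EntireSeq.natMul {a : ℕ → ℝ} (ha : EntireSeq a) : EntireSeq (fun k => (k : ℝ) * a k) := by
  intro r hr
  refine Summable.of_nonneg_of_le (fun k => by positivity) (fun k => ?_) (ha (2 * r) (by positivity))
  rw [abs_mul, Nat.abs_cast, mul_pow]
  have := nat_le_two_pow k
  have h2 : 0 ≤ |a k| * r ^ k := by positivity
  nlinarith [mul_le_mul_of_nonneg_right this h2]

lemma EntireSeq.shift {a : ℕ → ℝ} (ha : EntireSeq a) : EntireSeq (fun k => a (k + 1)) := by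
  intro r hr
  have h := (summable_nat_add_iff 1).2 (ha (r + 1) (by positivity))
  refine Summable.of_nonneg_of_le (fun k => by positivity) (fun k => ?_) h
  refine mul_le_mul_of_nonneg_left ?_ (abs_nonneg _)
  calc r ^ k ≤ (r + 1) ^ k := by gcongr; linarith
    _ ≤ (r + 1) ^ (k + 1) := pow_le_pow_right₀ (by linarith) (by omega)

lemma EntireSeq.add {a b : ℕ → ℝ} (ha : EntireSeq a) (hb : EntireSeq b) :
    EntireSeq (fun k => a k + b k) := by
  intro r hr
  refine Summable.of_nonneg_of_le (fun k => by positivity) (fun k => ?_) ((ha r hr).add (hb r hr))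
  rw [← add_mul]
  exact mul_le_mul_of_nonneg_right (abs_add_le _ _) (by positivity)

lemma EntireSeq.const {a : ℕ → ℝ} (ha : EntireSeq a) (c : ℝ) :
    EntireSeq (fun k => c * a k) := by
  intro r hr
  refine ((ha r hr).mul_left |c|).congr (fun k => ?_)
  rw [abs_mul, mul_assoc]

lemma EntireSeq.der {a : ℕ → ℝ} (ha : EntireSeq a) :
    EntireSeq (fun k => ((k : ℝ) + 1) * a (k + 1)) := by
  have := ha.natMul.shift
  simpa using this

lemma EntireSeq.summable {a : ℕ → ℝ} (ha : EntireSeq a) (t : ℝ) :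
    Summable (fun k => a k * t ^ k) := by
  refine Summable.of_norm ?_
  refine (ha |t| (abs_nonneg _)).congr (fun k => ?_)
  simp [abs_mul]

lemma EntireSeq.hasDerivAt {a : ℕ → ℝ} (ha : EntireSeq a) (t : ℝ) :
    HasDerivAt (GG a) (GG (fun k => ((k : ℝ) + 1) * a (k + 1)) t) t := by
  have hR : 0 < |t| + 1 := by positivity
  have hs : Summable (fun k : ℕ => ((k : ℝ) * |a k|) * (|t| + 1) ^ (k - 1)) := by
    rw [← summable_nat_add_iff 1]
    refine (ha.der (|t| + 1) hR.le).congr (fun k => ?_)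
    rw [abs_mul]
    have : |(k : ℝ) + 1| = k + 1 := abs_of_nonneg (by positivity)
    simp [this]
  have h := hasDerivAt_tsum_of_isPreconnected (t := Metric.ball (0 : ℝ) (|t| + 1))
    (g := fun (k : ℕ) (x : ℝ) => a k * x ^ k) (g' := fun (k : ℕ) (x : ℝ) => a k * (k * x ^ (k - 1)))
    (y₀ := 0) (y := t) hs Metric.isOpen_ball
    (convex_ball _ _).isPreconnected
    (fun k y _ => (hasDerivAt_pow k y).const_mul (a k))
    (fun k y hy => ?_) (by simpa using hR) (ha.summable 0) (by simp)
  · have e : (∑' k : ℕ, a k * (k * t ^ (k - 1))) = GG (fun k => ((k : ℝ) + 1) * a (k + 1)) t := by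
      have hsum : Summable (fun k : ℕ => a k * (k * t ^ (k - 1))) := by
        rw [← summable_nat_add_iff 1]
        refine (ha.der.summable t).congr (fun k => ?_)
        push_cast [Nat.add_sub_cancel]
        ring
      rw [hsum.tsum_eq_zero_add]
      unfold GG
      simp only [Nat.cast_zero, zero_mul, mul_zero, zero_add]
      refine tsum_congr (fun k => ?_)
      push_cast [Nat.add_sub_cancel]
      ring
    rw [← e]
    exact h
  · have hy' : |y| ≤ |t| + 1 := by
      have := mem_ball_zero_iff.1 hy
      exact this.le
    rw [norm_mul, norm_mul, norm_pow, Real.norm_eq_abs, Real.norm_eq_abs, Real.norm_eq_abs,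
      Nat.abs_cast]
    calc |a k| * (k * |y| ^ (k - 1)) ≤ |a k| * (k * (|t| + 1) ^ (k - 1)) := by gcongr
      _ = _ := by ring

noncomputable def LL (n : ℕ) (a : ℕ → ℝ) : ℕ → ℝ :=
  fun k => 4 * ((k : ℝ) * (((k : ℝ) + 1) * a (k + 1))) + (2 * n) * (((k : ℝ) + 1) * a (k + 1))

lemma EntireSeq.LL {a : ℕ → ℝ} (ha : EntireSeq a) (n : ℕ) : EntireSeq (LL n a) :=
  (ha.der.natMul.const 4).add (ha.der.const (2 * n))

lemma deriv_of_eqOn {a : ℕ → ℝ} (ha : EntireSeq a) {f : ℝ → ℝ}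
    (hf : ∀ x, 0 < x → f x = GG a (x ^ 2)) (x : ℝ) (hx : 0 < x) :
    deriv f x = 2 * x * GG (fun k => ((k : ℝ) + 1) * a (k + 1)) (x ^ 2) := by
  have he : f =ᶠ[𝓝 x] fun y => GG a (y ^ 2) := by
    filter_upwards [Ioi_mem_nhds hx] with y hy using hf y hy
  rw [he.deriv_eq]
  have h := (ha.hasDerivAt (x ^ 2)).comp x (hasDerivAt_pow 2 x)
  have h2 := h.deriv
  simp only [Function.comp_def] at h2
  rw [h2]
  push_cast
  ring

lemma radLap_of_eqOn {a : ℕ → ℝ} (ha : EntireSeq a) (n : ℕ) {f : ℝ → ℝ}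
    (hf : ∀ x, 0 < x → f x = GG a (x ^ 2)) (x : ℝ) (hx : 0 < x) :
    radLap n f x = GG (LL n a) (x ^ 2) := by
  have h1 := deriv_of_eqOn ha hf
  have he : deriv f =ᶠ[𝓝 x] fun y => 2 * y * GG (fun k => ((k : ℝ) + 1) * a (k + 1)) (y ^ 2) := by
    filter_upwards [Ioi_mem_nhds hx] with y hy using h1 y hy
  have hd := (ha.der.hasDerivAt (x ^ 2)).comp x (hasDerivAt_pow 2 x)
  have hd2 := (((hasDerivAt_id x).const_mul 2).mul hd).deriv
  simp only [Function.comp_def, id, Pi.mul_def] at hd2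
  unfold radLap
  rw [he.deriv_eq, h1 x hx, hd2]
  set b : ℕ → ℝ := fun k => ((k : ℝ) + 1) * a (k + 1) with hb
  have hbe : EntireSeq b := ha.der
  have e : GG (LL n a) (x ^ 2) = 4 * (x ^ 2 * GG (fun k => ((k : ℝ) + 1) * b (k + 1)) (x ^ 2))
      + (2 * n) * GG b (x ^ 2) := by
    have e1 : x ^ 2 * GG (fun k => ((k : ℝ) + 1) * b (k + 1)) (x ^ 2)
        = ∑' k : ℕ, (k : ℝ) * b k * (x ^ 2) ^ k := by
      have := hbe.natMul.summable (x ^ 2)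
      rw [this.tsum_eq_zero_add]
      unfold GG
      rw [← tsum_mul_left]
      simp only [Nat.cast_zero, zero_mul, zero_add]
      refine tsum_congr (fun k => ?_)
      push_cast
      ring
    rw [e1]
    unfold GG
    rw [← tsum_mul_left, ← tsum_mul_left, ← Summable.tsum_add]
    · refine tsum_congr (fun k => ?_)
      simp only [_root_.LL, hb]
      ring
    · exact (hbe.natMul.summable (x ^ 2)).mul_left 4
    · exact (hbe.summable (x ^ 2)).mul_left _
  rw [e]
  have e5 : (fun k : ℕ => ((k : ℝ) + 1) * ((((k + 1 : ℕ) : ℝ) + 1) * a (k + 1 + 1)))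
      = fun k : ℕ => ((k : ℝ) + 1) * b (k + 1) := rfl
  rw [e5]
  generalize GG (fun k : ℕ => ((k : ℝ) + 1) * b (k + 1)) (x ^ 2) = u
  generalize GG b (x ^ 2) = v
  push_cast
  field_simp
  ring

/-- moments -/
noncomputable def MM (m n k : ℕ) : ℝ :=
  ∫ s in Set.Ioi (0 : ℝ), s ^ ((n : ℝ) - 1 + 2 * k) * Real.exp (-s ^ ((2 * m : ℕ) : ℝ))

lemma MM_eq (m n k : ℕ) (hm : 1 ≤ m) (hn : 1 ≤ n) :
    MM m n k = (1 / (2 * m : ℝ)) * Real.Gamma (((n : ℝ) + 2 * k) / (2 * m)) := by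
  have hm' : (1 : ℝ) ≤ m := by exact_mod_cast hm
  have hn' : (1 : ℝ) ≤ n := by exact_mod_cast hn
  have hk : (0 : ℝ) ≤ k := Nat.cast_nonneg k
  unfold MM
  rw [integral_rpow_mul_exp_neg_rpow (by push_cast; linarith) (by linarith)]
  push_cast
  congr 3
  ring

lemma MM_integrable (m n k : ℕ) (hm : 1 ≤ m) (hn : 1 ≤ n) :
    IntegrableOn (fun s : ℝ => s ^ ((n : ℝ) - 1 + 2 * k) * Real.exp (-s ^ ((2 * m : ℕ) : ℝ)))
      (Set.Ioi 0) := by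
  have hm' : (1 : ℝ) ≤ m := by exact_mod_cast hm
  have hn' : (1 : ℝ) ≤ n := by exact_mod_cast hn
  have hk : (0 : ℝ) ≤ k := Nat.cast_nonneg k
  exact integrableOn_rpow_mul_exp_neg_rpow (by linarith) (by push_cast; linarith)

lemma MM_nonneg (m n k : ℕ) : 0 ≤ MM m n k := by
  unfold MM
  refine setIntegral_nonneg measurableSet_Ioi (fun s hs => ?_)
  have : (0 : ℝ) < s := hs
  positivity

lemma MM_step (m n k : ℕ) (hm : 1 ≤ m) (hn : 1 ≤ n) :
    MM m n (k + m) = ((k : ℝ) + n / 2) / m * MM m n k := by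
  have hm' : (1 : ℝ) ≤ m := by exact_mod_cast hm
  have hn' : (1 : ℝ) ≤ n := by exact_mod_cast hn
  have hk : (0 : ℝ) ≤ k := Nat.cast_nonneg k
  rw [MM_eq _ _ _ hm hn, MM_eq _ _ _ hm hn]
  have e : ((n : ℝ) + 2 * ((k + m : ℕ) : ℝ)) / (2 * m) = ((n : ℝ) + 2 * k) / (2 * m) + 1 := by
    push_cast
    field_simp
    ring
  rw [e, Real.Gamma_add_one (by positivity)]
  field_simp
  ring

lemma MM_le (m n k : ℕ) (hm : 1 ≤ m) (hn : 1 ≤ n) :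
    MM m n k ≤ Real.exp 1 * Real.Gamma ((k : ℝ) + n / 2) := by
  have hn' : (1 : ℝ) ≤ n := by exact_mod_cast hn
  have hk : (0 : ℝ) ≤ k := Nat.cast_nonneg k
  have h1 : MM m n k ≤ Real.exp 1 * MM 1 n k := by
    unfold MM
    rw [← integral_const_mul]
    refine setIntegral_mono_on (MM_integrable m n k hm hn)
      ((MM_integrable 1 n k le_rfl hn).const_mul _) measurableSet_Ioi (fun s hs => ?_)
    have hs : (0 : ℝ) < s := hs
    have hpow : s ^ 2 - 1 ≤ s ^ (2 * m) := by
      rcases le_total s 1 with h | h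
      · have : s ^ 2 ≤ 1 := pow_le_one₀ hs.le h
        have : 0 ≤ s ^ (2 * m) := by positivity
        linarith
      · have : s ^ 2 ≤ s ^ (2 * m) := pow_le_pow_right₀ h (by omega)
        linarith
    rw [Real.rpow_natCast, Real.rpow_natCast, mul_left_comm, ← Real.exp_add]
    refine mul_le_mul_of_nonneg_left (Real.exp_le_exp.2 ?_) (by positivity)
    norm_num
    linarith
  have hG : 0 < Real.Gamma ((k : ℝ) + n / 2) := Real.Gamma_pos_of_pos (by positivity)
  have h2 : MM 1 n k = 1 / 2 * Real.Gamma ((k : ℝ) + n / 2) := by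
    rw [MM_eq _ _ _ le_rfl hn]
    push_cast
    congr 2
    · ring
    · ring
  rw [h2] at h1
  nlinarith [mul_pos (Real.exp_pos 1) hG]

noncomputable def AA (c : ℝ) (m n j : ℕ) : ℕ → ℝ := fun k =>
  (-1) ^ j * c * (-1 / 4) ^ k * MM m n (k + j) / (Nat.factorial k * Real.Gamma ((k : ℝ) + n / 2))

lemma AA_entire (c : ℝ) (m n : ℕ) (hm : 1 ≤ m) (hn : 1 ≤ n) : EntireSeq (AA c m n 0) := by
  have hn' : (1 : ℝ) ≤ n := by exact_mod_cast hn
  intro r hr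
  refine Summable.of_nonneg_of_le (fun k => by positivity) (fun k => ?_)
    ((Real.summable_pow_div_factorial r).mul_left (|c| * Real.exp 1))
  have hk : (0 : ℝ) ≤ k := Nat.cast_nonneg k
  have hG : 0 < Real.Gamma ((k : ℝ) + n / 2) := Real.Gamma_pos_of_pos (by positivity)
  have hM := MM_le m n k hm hn
  have hM0 := MM_nonneg m n k
  have hf : (0 : ℝ) < Nat.factorial k := by exact_mod_cast Nat.factorial_pos k
  have hA : |AA c m n 0 k| = |c| * (1 / 4) ^ k * MM m n k /
      (Nat.factorial k * Real.Gamma ((k : ℝ) + n / 2)) := by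
    unfold AA
    rw [add_zero, abs_div, abs_mul, abs_mul, abs_mul, abs_pow, abs_pow, abs_of_nonneg hM0,
      abs_of_pos (mul_pos hf hG)]
    norm_num [abs_div]
  rw [hA]
  have h4 : (1 / 4 : ℝ) ^ k ≤ 1 := pow_le_one₀ (by norm_num) (by norm_num)
  calc |c| * (1 / 4) ^ k * MM m n k / (Nat.factorial k * Real.Gamma ((k : ℝ) + n / 2)) * r ^ k
      ≤ |c| * 1 * (Real.exp 1 * Real.Gamma ((k : ℝ) + n / 2)) /
        (Nat.factorial k * Real.Gamma ((k : ℝ) + n / 2)) * r ^ k := by gcongr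
    _ = _ := by field_simp

lemma AA_step (c : ℝ) (m n j : ℕ) (hn : 1 ≤ n) : LL n (AA c m n j) = AA c m n (j + 1) := by
  have hn' : (1 : ℝ) ≤ n := by exact_mod_cast hn
  funext k
  have hk : (0 : ℝ) ≤ k := Nat.cast_nonneg k
  have hG : 0 < Real.Gamma ((k : ℝ) + n / 2) := Real.Gamma_pos_of_pos (by positivity)
  have hf : (0 : ℝ) < Nat.factorial k := by exact_mod_cast Nat.factorial_pos k
  unfold LL AA
  have e : ((k + 1 : ℕ) : ℝ) + n / 2 = ((k : ℝ) + n / 2) + 1 := by push_cast; ring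
  rw [e, Real.Gamma_add_one (by positivity), Nat.factorial_succ,
    show k + 1 + j = k + (j + 1) by ring, pow_succ, pow_succ]
  push_cast
  field_simp
  ring

lemma LL_iter (c : ℝ) (m n : ℕ) (hm : 1 ≤ m) (hn : 1 ≤ n) (f : ℝ → ℝ)
    (hf : ∀ x, 0 < x → f x = GG (AA c m n 0) (x ^ 2)) (j : ℕ) :
    EntireSeq (AA c m n j) ∧
      ∀ x, 0 < x → (radLap n)^[j] f x = GG (AA c m n j) (x ^ 2) := by
  induction j with
  | zero => exact ⟨AA_entire c m n hm hn, hf⟩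
  | succ j ih =>
    rw [← AA_step c m n j hn]
    refine ⟨ih.1.LL n, fun x hx => ?_⟩
    rw [Function.iterate_succ_apply']
    exact radLap_of_eqOn ih.1 n ih.2 x hx

lemma fmn_eq_s6 (m n : ℕ) (hm : 1 ≤ m) (hn : 1 ≤ n) (x : ℝ) (hx : 0 < x) :
    fmn m n x = GG (AA ((1 / 2 : ℝ) ^ (((n : ℝ) - 2) / 2)) m n 0) (x ^ 2) := by
  have hn' : (1 : ℝ) ≤ n := by exact_mod_cast hn
  set c : ℝ := (1 / 2 : ℝ) ^ (((n : ℝ) - 2) / 2) with hc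
  have hA := AA_entire c m n hm hn
  let q : ℕ → ℝ := fun k => c * (-1 / 4) ^ k / (Nat.factorial k * Real.Gamma ((k : ℝ) + n / 2))
    * (x ^ 2) ^ k
  have hq : ∀ k, q k * MM m n k = AA c m n 0 k * (x ^ 2) ^ k := by
    intro k
    simp only [q, AA, pow_zero, add_zero]
    ring
  let F : ℕ → ℝ → ℝ := fun k s =>
    q k * (s ^ ((n : ℝ) - 1 + 2 * k) * Real.exp (-s ^ ((2 * m : ℕ) : ℝ)))
  have hFi : ∀ k, Integrable (F k) (volume.restrict (Set.Ioi 0)) := fun k =>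
    (MM_integrable m n k hm hn).const_mul _
  have hFs : Summable fun k => ∫ s in Set.Ioi (0 : ℝ), ‖F k s‖ := by
    refine (hA (x ^ 2) (by positivity)).congr (fun k => ?_)
    have e : ∫ s in Set.Ioi (0 : ℝ), ‖F k s‖ = |q k| * MM m n k := by
      unfold MM
      rw [← integral_const_mul]
      refine setIntegral_congr_fun measurableSet_Ioi (fun s hs => ?_)
      have hs : (0 : ℝ) < s := hs
      simp only [F]
      have hpos : 0 ≤ s ^ ((n : ℝ) - 1 + 2 * k) * Real.exp (-s ^ ((2 * m : ℕ) : ℝ)) := by positivity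
      rw [norm_mul, Real.norm_eq_abs, Real.norm_eq_abs, abs_of_nonneg hpos]
    rw [e, ← abs_of_nonneg (MM_nonneg m n k), ← abs_mul, hq, abs_mul,
      abs_of_nonneg (a := (x ^ 2) ^ k) (by positivity)]
  have hsum := integral_tsum_of_summable_integral_norm hFi hFs
  unfold fmn GG
  rw [← integral_const_mul]
  have e2 : ∑' k, AA c m n 0 k * (x ^ 2) ^ k = ∑' k, ∫ s in Set.Ioi (0 : ℝ), F k s := by
    refine tsum_congr (fun k => ?_)
    rw [← hq]
    unfold MM
    rw [← integral_const_mul]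
  rw [e2, hsum]
  refine setIntegral_congr_fun measurableSet_Ioi (fun s hs => ?_)
  have hs : (0 : ℝ) < s := hs
  simp only [besselJ]
  rw [← tsum_mul_left, ← tsum_mul_left]
  refine tsum_congr (fun k => ?_)
  simp only [F, q]
  rw [Real.rpow_natCast]
  have e3 : (k : ℝ) + ((n : ℝ) - 2) / 2 + 1 = k + n / 2 := by ring
  rw [e3]
  have p1 : (x * s / 2) ^ ((2 * k : ℝ) + ((n : ℝ) - 2) / 2)
      = (x * s) ^ ((2 * k : ℝ) + ((n : ℝ) - 2) / 2) * ((1 / 4) ^ k * c) := by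
    rw [div_eq_mul_one_div, Real.mul_rpow (by positivity) (by norm_num),
      Real.rpow_add (x := 1 / 2) (by norm_num), ← hc]
    congr 2
    rw [Real.rpow_mul (by norm_num), Real.rpow_natCast]
    norm_num
  have p2 : x ^ ((1 : ℝ) - n) * ((x * s) ^ ((n : ℝ) / 2) *
      (x * s) ^ ((2 * k : ℝ) + ((n : ℝ) - 2) / 2)) = (x ^ 2) ^ k * s ^ ((n : ℝ) - 1 + 2 * k) := by
    rw [← Real.rpow_add (by positivity), Real.mul_rpow hx.le hs.le, ← mul_assoc,
      ← Real.rpow_add hx]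
    have : (1 : ℝ) - n + (n / 2 + (2 * k + (n - 2) / 2)) = ((2 * k : ℕ) : ℝ) := by
      push_cast; ring
    rw [this, Real.rpow_natCast, pow_mul]
    congr 2
    ring
  have p3 : (-1 / 4 : ℝ) ^ k = (-1) ^ k * (1 / 4) ^ k := by rw [← mul_pow]; norm_num
  rw [p1, p3]
  linear_combination (Real.exp (-s ^ (2 * m)) * (-1) ^ k * ((1 / 4) ^ k * c) /
    (Nat.factorial k * Real.Gamma ((k : ℝ) + n / 2))) * p2

/-- the polyharmonic heat kernel profile satisfies the `(2m-1)`-order ODE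
`(Δ_r^{m-1} f_{m,n})'(η) = ((-1)^m/(2m)) η f_{m,n}(η)` for `η > 0`. -/
theorem fmn_higher_order_ODE (m n : ℕ) (hm : 1 ≤ m) (hn : 1 ≤ n) (η : ℝ) (hη : 0 < η) :
    deriv ((radLap n)^[m - 1] (fmn m n)) η
      = (-1 : ℝ) ^ m / (2 * m) * η * fmn m n η := by
  have hm' : (1 : ℝ) ≤ m := by exact_mod_cast hm
  have hn' : (1 : ℝ) ≤ n := by exact_mod_cast hn
  have h := LL_iter _ m n hm hn (fmn m n) (fmn_eq_s6 m n hm hn) (m - 1)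
  rw [deriv_of_eqOn h.1 h.2 η hη, fmn_eq_s6 m n hm hn η hη]
  set c : ℝ := (1 / 2 : ℝ) ^ (((n : ℝ) - 2) / 2)
  unfold GG
  rw [← tsum_mul_left, ← tsum_mul_left]
  refine tsum_congr (fun k => ?_)
  have hk : (0 : ℝ) ≤ k := Nat.cast_nonneg k
  have hG : 0 < Real.Gamma ((k : ℝ) + n / 2) := Real.Gamma_pos_of_pos (by positivity)
  have hf : (0 : ℝ) < Nat.factorial k := by exact_mod_cast Nat.factorial_pos k
  unfold AA
  have e : ((k + 1 : ℕ) : ℝ) + n / 2 = ((k : ℝ) + n / 2) + 1 := by push_cast; ring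
  obtain ⟨l, rfl⟩ : ∃ l, m = l + 1 := ⟨m - 1, by omega⟩
  beta_reduce
  rw [e, Real.Gamma_add_one (by positivity), Nat.factorial_succ, Nat.add_sub_cancel,
    show k + 1 + l = k + (l + 1) by ring, MM_step _ n k hm hn, pow_succ, pow_succ]
  have : (0 : ℝ) < k + n / 2 := by positivity
  push_cast
  field_simp
  ring
end
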